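/- Fix α with 1 < α < 3/2 and let the random fields be i.i.d. standard Gaussian. Then there exist h₀ > 0 and β₀ > 0 such that for every field strength h with 0 < h ≤ h₀ and every inverse temperature β ≥ β₀, the long-range order parameter satisfies m² > 0; that is, the random-field Ising model on the Dyson hierarchical lattice has long-range order at sufficiently low temperatures when the random field strength is sufficiently small but nonzero. -/

import Mathlib

open MeasureTheory ProbabilityTheory Filter
open scoped Classical

noncomputable section

/-- The spin value (±1) of a Boolean configuration entry. -/
def spin (b : Bool) : ℝ := if b then 1 else -1

/-- The total spin `S_{n,1} = Σ_i σ_i` of a configuration of `2^n` spins. -/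
def totalSpin (n : ℕ) (σ : Fin (2^n) → Bool) : ℝ := ∑ i, spin (σ i)

/-- The Dyson hierarchical Hamiltonian `H_N`, defined recursively:
`H_0 = 0`, `H_{N}(σ) = H_{N-1}(σ₁) + H_{N-1}(σ₂) - 2^{-αN} Σ_{i,j} σ_i σ_j`. -/
def dysonH (α : ℝ) : (N : ℕ) → (Fin (2^N) → Bool) → ℝ
  | 0, _ => 0
  | (N+1), σ =>
      dysonH α N (fun i => σ ⟨i.1, by have := i.2; rw [pow_succ]; omega⟩)
    + dysonH α N (fun i => σ ⟨2^N + i.1, by have := i.2; rw [pow_succ]; omega⟩)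
    - (2:ℝ) ^ (-(α * ((N:ℝ)+1))) *
        ∑ i : Fin (2^(N+1)), ∑ j : Fin (2^(N+1)), spin (σ i) * spin (σ j)

/-- The random-field Hamiltonian `H_N^{RF}(σ) = H_N(σ) - h Σ_i h_i σ_i`,
where `fh` is the field strength and `η` the realization of the random fields. -/
def dysonHRF (α fh : ℝ) (N : ℕ) (η : Fin (2^N) → ℝ) (σ : Fin (2^N) → Bool) : ℝ :=
  dysonH α N σ - fh * ∑ i, η i * spin (σ i)

/-- The Gibbs average `⟨F⟩_N` with weight `exp(-β H_N^{RF}(σ))`. -/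
def gibbs (α β fh : ℝ) (N : ℕ) (η : Fin (2^N) → ℝ) (F : (Fin (2^N) → Bool) → ℝ) : ℝ :=
  (∑ σ, F σ * Real.exp (-β * dysonHRF α fh N η σ)) /
    ∑ σ, Real.exp (-β * dysonHRF α fh N η σ)

/-- The law of `n` i.i.d. standard Gaussian random fields. -/
def gaussianFields (n : ℕ) : Measure (Fin n → ℝ) :=
  Measure.pi fun _ => gaussianReal 0 1

/-- Expectation with respect to `n` i.i.d. symmetric Bernoulli (±1) random fields,
i.e. the uniform average over `{-1,+1}^n`. -/
def bernoulliExp (n : ℕ) (F : (Fin n → ℝ) → ℝ) : ℝ :=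
  ((2:ℝ)^n)⁻¹ * ∑ ε : Fin n → Bool, F (fun i => spin (ε i))

/-- `f_N = 2^{-2N} E[⟨S_{N,1}²⟩_N]` with i.i.d. standard Gaussian random fields. -/
def fG (α β fh : ℝ) (N : ℕ) : ℝ :=
  ((2:ℝ)^(2*N))⁻¹ *
    ∫ η, gibbs α β fh N η (fun σ => (totalSpin N σ)^2) ∂ gaussianFields (2^N)

/-- `f_N = 2^{-2N} E[⟨S_{N,1}²⟩_N]` with i.i.d. symmetric Bernoulli random fields. -/
def fB (α β fh : ℝ) (N : ℕ) : ℝ :=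
  ((2:ℝ)^(2*N))⁻¹ *
    bernoulliExp (2^N) (fun η => gibbs α β fh N η (fun σ => (totalSpin N σ)^2))

/-- `b_n = 2^{(2-α)n}`. -/
def bcoef (α : ℝ) (n : ℕ) : ℝ := (2:ℝ) ^ (((2:ℝ) - α) * n)

/-- The first half `(h_1, …, h_{2^{N-1}})` of the random fields. -/
def half1 (N : ℕ) (η : Fin (2^N) → ℝ) : Fin (2^(N-1)) → ℝ :=
  fun i => η ⟨i.1, lt_of_lt_of_le i.2 (Nat.pow_le_pow_right (by norm_num) (Nat.sub_le N 1))⟩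

/-- The second half `(h_{2^{N-1}+1}, …, h_{2^N})` of the random fields. -/
def half2 (N : ℕ) (η : Fin (2^N) → ℝ) : Fin (2^(N-1)) → ℝ :=
  fun i => if hlt : 2^(N-1) + i.1 < 2^N then η ⟨2^(N-1) + i.1, hlt⟩ else 0

/-- Membership in the `k`-th of the `r` equal subintervals `I_k` of `[-2^{N-1}, 2^{N-1}]`. -/
def inBlock (N r k : ℕ) (x : ℝ) : Prop :=
  -(2:ℝ)^(N-1) + ((k:ℝ)-1) * ((2:ℝ)^N / r) ≤ x ∧
    x ≤ -(2:ℝ)^(N-1) + (k:ℝ) * ((2:ℝ)^N / r)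

/-- The restricted partition function
`Z_k(η) = Σ_{σ : S_{N-1} ∈ I_k} exp(-β H_{N-1}^{RF}(σ) + 2β b_N 2^{-2N} S_{N-1}²)`,
on `2^{N-1}` spins with fields `η`. Both `Z_{k,1}` and `Z_{k,2}` are this function,
applied to the first resp. second half of the random fields. -/
def Zres (α β fh : ℝ) (N r k : ℕ) (η : Fin (2^(N-1)) → ℝ) : ℝ :=
  ∑ σ : Fin (2^(N-1)) → Bool,
    if inBlock N r k (totalSpin (N-1) σ) then
      Real.exp (-β * dysonHRF α fh (N-1) η σ
        + 2 * β * bcoef α N * ((2:ℝ)^(2*N))⁻¹ * (totalSpin (N-1) σ)^2)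
    else 0

/-- `g_k = log (Z_{k,1}(h₁) / Z_{k,2}(h₂))` as a function of all the random fields. -/
def gk (α β fh : ℝ) (N r k : ℕ) (η : Fin (2^N) → ℝ) : ℝ :=
  Real.log (Zres α β fh N r k (half1 N η) / Zres α β fh N r k (half2 N η))

/-- `max_{1 ≤ k ≤ r} g_k`. -/
def maxgk (α β fh : ℝ) (N r : ℕ) (hr : 1 ≤ r) (η : Fin (2^N) → ℝ) : ℝ :=
  (Finset.Icc 1 r).sup' (Finset.nonempty_Icc.mpr hr) (fun k => gk α β fh N r k η)

/-- The sum of the spins in the `B`-th consecutive block of size `2^n` (out of `2^{N-n}`). -/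
def blockSum (N n : ℕ) (σ : Fin (2^N) → Bool) (B : Fin (2^(N-n))) : ℝ :=
  ∑ j : Fin (2^n), if hlt : B.1 * 2^n + j.1 < 2^N then spin (σ ⟨B.1 * 2^n + j.1, hlt⟩) else 0

/-- The generalized pressure
`P_N(v_N, …, v_1) = log Σ_σ exp(Σ_{n=1}^N v_n Σ_B (Σ_{i∈B} σ_i)² + β h Σ_i h_i σ_i)`
for a given realization `η` of the random fields; the quenched pressure is its
expectation over the fields. -/
def pressure (β fh : ℝ) (N : ℕ) (v : ℕ → ℝ) (η : Fin (2^N) → ℝ) : ℝ :=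
  Real.log (∑ σ : Fin (2^N) → Bool,
    Real.exp ((∑ n ∈ Finset.Icc 1 N, v n * ∑ B : Fin (2^(N-n)), (blockSum N n σ B)^2)
      + β * fh * ∑ i, η i * spin (σ i)))

/-- The couplings `v_n = β b_n 2^{-2n}` corresponding to `-β H_N`. -/
def vcoup (α β : ℝ) (n : ℕ) : ℝ := β * bcoef α n * ((2:ℝ)^(2*n))⁻¹

/-- `f_N = 2^{-2N} ⟨S_{N,1}²⟩_N` without random field. -/
def fNoField (α β : ℝ) (N : ℕ) : ℝ :=
  ((2:ℝ)^(2*N))⁻¹ * gibbs α β 0 N (fun _ => 0) (fun σ => (totalSpin N σ)^2)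

/-- The `p`-th term of the series bounding `1 - f_N` from above. -/
def seriesTerm (α β fh c : ℝ) (p : ℕ) : ℝ :=
  (1/(β * bcoef α p)) * (β/c + Real.log (2 * Real.sqrt (c * bcoef α p))
    + β * fh * (2:ℝ)^((p:ℝ)/2) *
      Real.log (2 * Real.sqrt (c * bcoef α p) * (1 + Real.sqrt (2*Real.pi*Real.exp 1))))

section Helpers

open Real

lemma gauss_exp_int (c : ℝ) : Integrable (fun x : ℝ => exp (c * |x|)) (gaussianReal 0 1) :=
  integrable_exp_mul_abs (X := fun x => x) (integrable_exp_mul_gaussianReal c)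
    (integrable_exp_mul_gaussianReal (-c))

instance (n : ℕ) : IsProbabilityMeasure (gaussianFields n) := by
  unfold gaussianFields; infer_instance

lemma lip_integrable {n : ℕ} {L : ℝ} {F : (Fin n → ℝ) → ℝ} (hm : Measurable F)
    (hp : ∀ x, 0 < F x) (hl : ∀ x y, F x ≤ exp (L * ∑ i, |x i - y i|) * F y) :
    Integrable F (gaussianFields n) := by
  have h1 : Integrable (fun x : Fin n → ℝ => ∏ i, exp (L * |x i|)) (gaussianFields n) := by
    unfold gaussianFields
    exact Integrable.fintype_prod (f := fun _ x => exp (L * |x|)) (fun i => gauss_exp_int L)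
  refine (h1.mul_const (F 0)).mono' hm.aestronglyMeasurable (Eventually.of_forall fun x => ?_)
  rw [Real.norm_eq_abs, abs_of_pos (hp x), ← Real.exp_sum, ← Finset.mul_sum]
  simpa using hl x 0

lemma lip_inv {n : ℕ} {L : ℝ} {F : (Fin n → ℝ) → ℝ}
    (hp : ∀ x, 0 < F x) (hl : ∀ x y, F x ≤ exp (L * ∑ i, |x i - y i|) * F y) :
    ∀ x y, (F x)⁻¹ ≤ exp (L * ∑ i, |x i - y i|) * (F y)⁻¹ := by
  intro x y
  have h := hl y x
  simp_rw [abs_sub_comm (y _) (x _)] at h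
  rw [← div_eq_mul_inv, le_div_iff₀ (hp y), inv_mul_le_iff₀ (hp x), mul_comm]
  exact h

lemma one_dim {L : ℝ} {A : ℝ → ℝ} (hm : Measurable A) (hp : ∀ x, 0 < A x)
    (hl : ∀ x y, A x ≤ exp (L * |x - y|) * A y) :
    (Integrable A (gaussianReal 0 1) ∧ Integrable (fun x => (A x)⁻¹) (gaussianReal 0 1)) ∧
    (∫ x, A x ∂gaussianReal 0 1) * (∫ x, (A x)⁻¹ ∂gaussianReal 0 1) ≤ exp (L ^ 2) := by
  have hi : Integrable A (gaussianReal 0 1) := by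
    refine ((gauss_exp_int L).mul_const (A 0)).mono' hm.aestronglyMeasurable
      (Eventually.of_forall fun x => ?_)
    rw [Real.norm_eq_abs, abs_of_pos (hp x)]
    simpa using hl x 0
  have hi' : Integrable (fun x => (A x)⁻¹) (gaussianReal 0 1) := by
    refine ((gauss_exp_int L).mul_const (A 0)⁻¹).mono' hm.inv.aestronglyMeasurable
      (Eventually.of_forall fun x => ?_)
    rw [Real.norm_eq_abs, abs_of_pos (inv_pos.2 (hp x))]
    have h := hl 0 x
    simp only [zero_sub, abs_neg] at h
    rw [← div_eq_mul_inv, le_div_iff₀ (hp 0), inv_mul_le_iff₀ (hp x), mul_comm]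
    exact h
  refine ⟨⟨hi, hi'⟩, ?_⟩
  have e1 := integral_prod_mul (μ := gaussianReal 0 1) (ν := gaussianReal 0 1) A (fun y => (A y)⁻¹)
  have e2 := integral_prod_mul (μ := gaussianReal 0 1) (ν := gaussianReal 0 1) (fun y => (A y)⁻¹) A
  have e3 := integral_prod_mul (μ := gaussianReal 0 1) (ν := gaussianReal 0 1)
    (fun x => exp (L * x)) (fun x => exp (-L * x))
  have e4 := integral_prod_mul (μ := gaussianReal 0 1) (ν := gaussianReal 0 1)
    (fun x => exp (-L * x)) (fun x => exp (L * x))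
  have m1 : ∀ c : ℝ, ∫ x, exp (c * x) ∂gaussianReal 0 1 = exp (c ^ 2 / 2) := by
    intro c
    have := congrFun (mgf_id_gaussianReal (μ := 0) (v := 1)) c
    simpa [mgf] using this
  rw [m1, m1] at e3 e4
  have i1 := hi.mul_prod hi'
  have i2 := hi'.mul_prod hi
  have i3 := (integrable_exp_mul_gaussianReal (μ := 0) (v := 1) L).mul_prod
    (integrable_exp_mul_gaussianReal (μ := 0) (v := 1) (-L))
  have i4 := (integrable_exp_mul_gaussianReal (μ := 0) (v := 1) (-L)).mul_prod
    (integrable_exp_mul_gaussianReal (μ := 0) (v := 1) L)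
  have key := integral_mono (i1.add i2) (i3.add i4) (fun z => by
    obtain ⟨x, y⟩ := z
    have hx := hp x
    have hy := hp y
    simp only [Pi.add_apply]
    have h1 := hl x y
    have h2 := hl y x
    rw [abs_sub_comm] at h2
    have hs : exp (L * x) * exp (-L * y) + exp (-L * x) * exp (L * y)
        = exp (L * |x - y|) + exp (-(L * |x - y|)) := by
      rw [← Real.exp_add, ← Real.exp_add]
      rcases abs_cases (x - y) with ⟨h, _⟩ | ⟨h, _⟩ <;> rw [h]
      · congr 2 <;> ring
      · rw [add_comm]; congr 2 <;> ring
    rw [hs]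
    set E := exp (L * |x - y|) with hE
    have hE0 : 0 < E := Real.exp_pos _
    rw [Real.exp_neg, ← hE]
    have hu : A x * (A y)⁻¹ + (A y) * (A x)⁻¹ ≤ E + E⁻¹ := by
      have : (E + E⁻¹) - (A x * (A y)⁻¹ + (A y) * (A x)⁻¹)
        = (E * A y - A x) * (E * A x - A y) / (E * A x * A y) := by
        field_simp
        ring
      have h3 : 0 ≤ (E * A y - A x) * (E * A x - A y) / (E * A x * A y) := by
        apply div_nonneg (mul_nonneg (by linarith) (by linarith)) (by positivity)
      linarith
    rw [mul_comm (A x)⁻¹]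
    exact hu)
  rw [integral_add' i1 i2, integral_add' i3 i4, e1, e2, e3, e4, ← Real.exp_add, ← Real.exp_add] at key
  have q : L ^ 2 / 2 + (-L) ^ 2 / 2 = L ^ 2 := by ring
  have q' : (-L) ^ 2 / 2 + L ^ 2 / 2 = L ^ 2 := by ring
  rw [q, q'] at key
  linarith [mul_comm (∫ x, A x ∂gaussianReal 0 1) (∫ x, (A x)⁻¹ ∂gaussianReal 0 1)]

lemma exp_mom {L : ℝ} : ∀ (n : ℕ) (F : (Fin n → ℝ) → ℝ), Measurable F →
    (∀ x, 0 < F x) → (∀ x y, F x ≤ exp (L * ∑ i, |x i - y i|) * F y) →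
    (∫ x, F x ∂gaussianFields n) * (∫ x, (F x)⁻¹ ∂gaussianFields n) ≤ exp (n * L ^ 2) := by
  intro n
  induction n with
  | zero =>
    intro F hm hp hl
    have h0 : ∀ x : Fin 0 → ℝ, F x = F 0 := fun x => by rw [Subsingleton.elim x 0]
    simp [h0, mul_inv_cancel₀ (hp 0).ne']
  | succ n ih =>
    intro F hm hp hl
    have mp := (measurePreserving_piFinSuccAbove (fun _ : Fin (n+1) => gaussianReal 0 1) 0).symm
    have hFi : Integrable F (gaussianFields (n+1)) := lip_integrable hm hp hl
    have hGi : Integrable (fun x => (F x)⁻¹) (gaussianFields (n+1)) :=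
      lip_integrable hm.inv (fun x => inv_pos.2 (hp x)) (lip_inv hp hl)
    set e := (MeasurableEquiv.piFinSuccAbove (fun _ : Fin (n+1) => ℝ) 0).symm with he
    have hcons : ∀ z, e z = Fin.cons z.1 z.2 := by
      intro z
      ext i
      refine Fin.cases ?_ (fun j => ?_) i <;> rfl
    have hI : ∀ G : (Fin (n+1) → ℝ) → ℝ, Integrable G (gaussianFields (n+1)) →
        Integrable (fun z : ℝ × (Fin n → ℝ) => G (Fin.cons z.1 z.2))
          ((gaussianReal 0 1).prod (gaussianFields n)) ∧
        ∫ x, G x ∂gaussianFields (n+1) = ∫ x, ∫ y, G (Fin.cons x y) ∂gaussianFields n ∂gaussianReal 0 1 := by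
      intro G hG
      have hh : Integrable (fun z : ℝ × (Fin n → ℝ) => G (Fin.cons z.1 z.2))
          ((gaussianReal 0 1).prod (gaussianFields n)) := by
        have := (mp.integrable_comp_emb e.measurableEmbedding (g := G)).2 hG
        refine this.congr (Eventually.of_forall fun z => ?_)
        simp only [Function.comp]
        rw [hcons]
      refine ⟨hh, ?_⟩
      rw [← integral_prod _ hh]
      have := mp.integral_comp e.measurableEmbedding G
      simp_rw [hcons] at this
      exact this.symm
    obtain ⟨iF, eF⟩ := hI F hFi
    obtain ⟨iG, eG⟩ := hI _ hGi
    rw [eF, eG]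
    have hmc : Measurable (fun z : ℝ × (Fin n → ℝ) => (Fin.cons z.1 z.2 : Fin (n+1) → ℝ)) := by
      have := e.measurable
      rwa [show (e : ℝ × (Fin n → ℝ) → _) = fun z => Fin.cons z.1 z.2 from funext hcons] at this
    have hmx : ∀ x : ℝ, Measurable (fun y : Fin n → ℝ => (Fin.cons x y : Fin (n+1) → ℝ)) :=
      fun x => hmc.comp measurable_prodMk_left
    have hlx : ∀ x : ℝ, ∀ y y' : Fin n → ℝ, F (Fin.cons x y) ≤
        exp (L * ∑ i, |y i - y' i|) * F (Fin.cons x y') := by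
      intro x y y'
      have := hl (Fin.cons x y) (Fin.cons x y')
      simpa [Fin.sum_univ_succ] using this
    have hpx : ∀ x : ℝ, ∀ y : Fin n → ℝ, 0 < F (Fin.cons x y) := fun x y => hp _
    have ix : ∀ x : ℝ, Integrable (fun y : Fin n → ℝ => F (Fin.cons x y)) (gaussianFields n) :=
      fun x => lip_integrable (hm.comp (hmx x)) (hpx x) (hlx x)
    set A : ℝ → ℝ := fun x => ∫ y, F (Fin.cons x y) ∂gaussianFields n with hA
    set B : ℝ → ℝ := fun x => ∫ y, (F (Fin.cons x y))⁻¹ ∂gaussianFields n with hB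
    have hAp : ∀ x, 0 < A x := fun x =>
      (integral_pos_iff_support_of_nonneg (fun y => (hpx x y).le) (ix x)).2 (by
        rw [show Function.support (fun y : Fin n → ℝ => F (Fin.cons x y)) = Set.univ from
          Set.eq_univ_of_forall (fun y => (hpx x y).ne')]
        simp)
    have hAB : ∀ x, A x * B x ≤ exp (n * L ^ 2) := fun x =>
      ih (fun y => F (Fin.cons x y)) (hm.comp (hmx x)) (hpx x) (hlx x)
    have hAm : Measurable A :=
      ((hm.comp hmc).stronglyMeasurable.integral_prod_right' (ν := gaussianFields n)).measurable
    have hAl : ∀ x y, A x ≤ exp (L * |x - y|) * A y := by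
      intro x x'
      simp only [hA]
      rw [← integral_const_mul]
      refine integral_mono (ix x) ((ix x').const_mul _) (fun y => ?_)
      have := hl (Fin.cons x y) (Fin.cons x' y)
      simpa [Fin.sum_univ_succ] using this
    obtain ⟨⟨hAi, hAi'⟩, hone⟩ := one_dim hAm hAp hAl
    have hBle : ∫ x, B x ∂gaussianReal 0 1 ≤ exp (n * L^2) * ∫ x, (A x)⁻¹ ∂gaussianReal 0 1 := by
      rw [← integral_const_mul]
      refine integral_mono iG.integral_prod_left (hAi'.const_mul _) (fun x => ?_)
      change B x ≤ _
      rw [← div_eq_mul_inv, le_div_iff₀ (hAp x), mul_comm]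
      exact hAB x
    have hA0 : 0 ≤ ∫ x, A x ∂gaussianReal 0 1 := integral_nonneg fun x => (hAp x).le
    calc _ ≤ (∫ x, A x ∂gaussianReal 0 1) * (exp (n * L^2) * ∫ x, (A x)⁻¹ ∂gaussianReal 0 1) :=
          mul_le_mul_of_nonneg_left hBle hA0
      _ = exp (n * L^2) * ((∫ x, A x ∂gaussianReal 0 1) * ∫ x, (A x)⁻¹ ∂gaussianReal 0 1) := by ring
      _ ≤ exp (n * L^2) * exp (L^2) := by gcongr
      _ = _ := by rw [← Real.exp_add]; congr 1; push_cast; ring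

lemma gibbs_jensen {Ω : Type*} [Fintype Ω] [Nonempty Ω] (w f : Ω → ℝ) (hw : ∀ σ, 0 < w σ) :
    (∑ σ, f σ * w σ) / (∑ σ, w σ) ≤ log (∑ σ, w σ * exp (f σ)) - log (∑ σ, w σ) := by
  have hW : 0 < ∑ σ, w σ := Finset.sum_pos (fun σ _ => hw σ) Finset.univ_nonempty
  set m := (∑ σ, f σ * w σ) / (∑ σ, w σ) with hm
  have h1 : exp m * (∑ σ, w σ) ≤ ∑ σ, w σ * exp (f σ) := by
    have h2 : ∀ σ, w σ * (exp m * (1 + (f σ - m))) ≤ w σ * exp (f σ) := by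
      intro σ
      apply mul_le_mul_of_nonneg_left _ (hw σ).le
      have := Real.add_one_le_exp (f σ - m)
      calc exp m * (1 + (f σ - m)) ≤ exp m * exp (f σ - m) := by
            apply mul_le_mul_of_nonneg_left _ (exp_pos m).le; linarith
        _ = exp (f σ) := by rw [← Real.exp_add]; congr 1; ring
    refine le_trans (le_of_eq ?_) (Finset.sum_le_sum fun σ _ => h2 σ)
    have h3 : ∑ σ, w σ * (exp m * (1 + (f σ - m)))
        = exp m * (∑ σ, w σ) + exp m * (∑ σ, f σ * w σ) - exp m * m * (∑ σ, w σ) := by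
      simp only [Finset.mul_sum, ← Finset.sum_add_distrib, ← Finset.sum_sub_distrib]
      exact Finset.sum_congr rfl fun σ _ => by ring
    have h4 : ∑ σ, f σ * w σ = m * ∑ σ, w σ := by rw [hm]; field_simp
    rw [h3, h4]; ring
  have h5 := Real.log_le_log (by positivity) h1
  rw [Real.log_mul (exp_pos m).ne' hW.ne', Real.log_exp] at h5
  linarith

/-- restricted sum -/
def Zp {Ω : Type*} [Fintype Ω] (lab : Ω → ℤ) (w : Ω → ℝ) (k : ℤ) : ℝ :=
  ∑ σ ∈ Finset.univ.filter (fun σ => lab σ = k), w σ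

lemma Zp_pos {Ω : Type*} [Fintype Ω] (lab : Ω → ℤ) (w : Ω → ℝ) (hw : ∀ σ, 0 < w σ) (k : ℤ)
    (hk : k ∈ Finset.univ.image lab) : 0 < Zp lab w k := by
  obtain ⟨σ, _, rfl⟩ := Finset.mem_image.1 hk
  exact Finset.sum_pos (fun σ _ => hw σ) ⟨σ, by simp⟩

lemma Zp_sum {Ω : Type*} [Fintype Ω] (lab : Ω → ℤ) (w : Ω → ℝ) :
    ∑ σ, w σ = ∑ k ∈ Finset.univ.image lab, Zp lab w k := by
  unfold Zp
  rw [Finset.sum_fiberwise_of_maps_to]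
  intro σ _
  exact Finset.mem_image_of_mem _ (Finset.mem_univ _)

lemma core {Ω : Type*} [Fintype Ω] [Nonempty Ω] (w1 w2 S : Ω → ℝ) (h1 : ∀ σ, 0 < w1 σ)
    (h2 : ∀ σ, 0 < w2 σ) (lab : Ω → ℤ) (v δ U V : ℝ) (hv : 0 ≤ v)
    (hδ : ∀ σ τ, lab σ = lab τ → (S σ - S τ)^2 ≤ δ^2)
    (hU : ∀ k ∈ Finset.univ.image lab, Zp lab (fun σ => w1 σ * exp (2*v*S σ^2)) k
      ≤ exp U * Zp lab (fun σ => w2 σ * exp (2*v*S σ^2)) k)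
    (hV : ∀ k ∈ Finset.univ.image lab, Zp lab (fun σ => w2 σ * exp (2*v*S σ^2)) k
      ≤ exp V * Zp lab (fun σ => w1 σ * exp (2*v*S σ^2)) k) :
    log (∑ σ, w1 σ * exp (2*v*S σ^2)) + log (∑ σ, w2 σ * exp (2*v*S σ^2))
      ≤ log (∑ p : Ω × Ω, w1 p.1 * w2 p.2 * exp (v * (S p.1 + S p.2)^2)) + v * δ^2
        + 2 * log ((Finset.univ.image lab).card) + (U + V)/2 := by
  set K := Finset.univ.image lab with hK
  set W1 := fun σ => w1 σ * exp (2*v*S σ^2) with hW1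
  set W2 := fun σ => w2 σ * exp (2*v*S σ^2) with hW2
  have hW1p : ∀ σ, 0 < W1 σ := fun σ => mul_pos (h1 σ) (exp_pos _)
  have hW2p : ∀ σ, 0 < W2 σ := fun σ => mul_pos (h2 σ) (exp_pos _)
  set Z := ∑ p : Ω × Ω, w1 p.1 * w2 p.2 * exp (v * (S p.1 + S p.2)^2) with hZ
  have hZp : 0 < Z := Finset.sum_pos
    (fun p _ => mul_pos (mul_pos (h1 _) (h2 _)) (exp_pos _)) Finset.univ_nonempty
  have hM : ∀ k ∈ K, Zp lab W1 k * Zp lab W2 k ≤ exp (v * δ^2) * Z := by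
    intro k _
    unfold Zp
    rw [Finset.sum_mul_sum, ← Finset.sum_product', hZ, Finset.mul_sum]
    refine le_trans (Finset.sum_le_sum ?_)
      (Finset.sum_le_sum_of_subset_of_nonneg (Finset.subset_univ _)
        (f := fun p : Ω × Ω => exp (v * δ^2) * (w1 p.1 * w2 p.2 * exp (v * (S p.1 + S p.2)^2)))
        (fun p _ _ => mul_nonneg (exp_pos _).le
          (mul_nonneg (mul_nonneg (h1 _).le (h2 _).le) (exp_pos _).le)))
    intro p hp
    simp only [Finset.mem_product, Finset.mem_filter, Finset.mem_univ, true_and] at hp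
    have hd := hδ p.1 p.2 (hp.1.trans hp.2.symm)
    have hp12 : 0 < w1 p.1 * w2 p.2 := mul_pos (h1 _) (h2 _)
    calc W1 p.1 * W2 p.2 = w1 p.1 * w2 p.2 * exp (2*v*S p.1^2 + 2*v*S p.2^2) := by
          rw [Real.exp_add]; simp only [hW1, hW2]; ring
      _ ≤ w1 p.1 * w2 p.2 * exp (v * δ^2 + v * (S p.1 + S p.2)^2) := by
          apply mul_le_mul_of_nonneg_left _ hp12.le
          apply Real.exp_le_exp.2
          nlinarith [mul_le_mul_of_nonneg_left hd hv]
      _ = _ := by rw [Real.exp_add]; ring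
  have hkl : ∀ k ∈ K, ∀ l ∈ K, Zp lab W1 k * Zp lab W2 l ≤ exp ((U+V)/2) * (exp (v * δ^2) * Z) := by
    intro k hk l hl
    have a1 := Zp_pos lab W1 hW1p k hk
    have a2 := Zp_pos lab W2 hW2p k hk
    have b1 := Zp_pos lab W1 hW1p l hl
    have b2 := Zp_pos lab W2 hW2p l hl
    refine (pow_le_pow_iff_left₀ (by positivity) (by positivity) two_ne_zero).1 ?_
    calc (Zp lab W1 k * Zp lab W2 l)^2 = (Zp lab W1 k * Zp lab W2 l) * (Zp lab W1 k * Zp lab W2 l) := by ring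
      _ ≤ ((exp U * Zp lab W2 k) * (exp V * Zp lab W1 l)) * (Zp lab W1 k * Zp lab W2 l) := by
          gcongr
          · exact hU k hk
          · exact hV l hl
      _ = (exp U * exp V) * ((Zp lab W1 k * Zp lab W2 k) * (Zp lab W1 l * Zp lab W2 l)) := by ring
      _ ≤ (exp U * exp V) * ((exp (v * δ^2) * Z) * (exp (v * δ^2) * Z)) := by
          have m1 := hM k hk
          have m2 := hM l hl
          refine mul_le_mul_of_nonneg_left (mul_le_mul m1 m2 ?_ ?_) ?_ <;> positivity
      _ = _ := by
          rw [← Real.exp_add, mul_pow, ← Real.exp_nat_mul]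
          push_cast
          rw [show 2 * ((U+V)/2) = U + V by ring]; ring
  have hsum : (∑ σ, W1 σ) * (∑ σ, W2 σ) ≤ (K.card : ℝ)^2 * (exp ((U+V)/2) * (exp (v * δ^2) * Z)) := by
    rw [Zp_sum lab W1, Zp_sum lab W2, Finset.sum_mul_sum]
    calc _ ≤ ∑ k ∈ K, ∑ l ∈ K, exp ((U+V)/2) * (exp (v * δ^2) * Z) :=
          Finset.sum_le_sum fun k hk => Finset.sum_le_sum fun l hl => hkl k hk l hl
      _ = _ := by simp only [Finset.sum_const, nsmul_eq_mul]; ring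
  have s1 : 0 < ∑ σ, W1 σ := Finset.sum_pos (fun σ _ => hW1p σ) Finset.univ_nonempty
  have s2 : 0 < ∑ σ, W2 σ := Finset.sum_pos (fun σ _ => hW2p σ) Finset.univ_nonempty
  have hKc : (0:ℝ) < K.card := by
    exact_mod_cast Finset.card_pos.2 (Finset.univ_nonempty.image lab)
  have := Real.log_le_log (mul_pos s1 s2) hsum
  rw [Real.log_mul s1.ne' s2.ne', Real.log_mul (by positivity) (by positivity),
    Real.log_mul (by positivity) (by positivity), Real.log_mul (by positivity) (by positivity),
    Real.log_pow, Real.log_exp, Real.log_exp] at this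
  push_cast at this
  linarith

lemma ratio_bd (K : Finset ℤ) (a b : ℤ → ℝ) (ha : ∀ k ∈ K, 0 < a k) (hb : ∀ k ∈ K, 0 < b k)
    (t A : ℝ) (ht : 0 < t) (hA : 0 < A) :
    ∀ k ∈ K, a k ≤ exp ((log A + (∑ j ∈ K, a j ^ t * (b j ^ t)⁻¹) / A - 1)/t) * b k := by
  intro k hk
  set Y := ∑ j ∈ K, a j ^ t * (b j ^ t)⁻¹ with hY
  have hterm : ∀ j ∈ K, 0 < a j ^ t * (b j ^ t)⁻¹ := fun j hj =>
    mul_pos (Real.rpow_pos_of_pos (ha j hj) t) (inv_pos.2 (Real.rpow_pos_of_pos (hb j hj) t))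
  have h1 : a k ^ t * (b k ^ t)⁻¹ ≤ Y :=
    Finset.single_le_sum (f := fun j => a j ^ t * (b j ^ t)⁻¹) (fun j hj => (hterm j hj).le) hk
  have hYp : 0 < Y := (hterm k hk).trans_le h1
  have h2 : log Y ≤ log A + Y / A - 1 := by
    have := Real.log_le_sub_one_of_pos (div_pos hYp hA)
    rw [Real.log_div hYp.ne' hA.ne'] at this
    linarith
  have h3 := Real.log_le_log (hterm k hk) h1
  have ha' := ha k hk
  have hb' := hb k hk
  rw [Real.log_mul (Real.rpow_pos_of_pos ha' t).ne' (inv_pos.2 (Real.rpow_pos_of_pos hb' t)).ne',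
    Real.log_inv, Real.log_rpow ha', Real.log_rpow hb'] at h3
  rw [← Real.log_le_log_iff ha' (by positivity), Real.log_mul (exp_pos _).ne' hb'.ne', Real.log_exp]
  have : log (a k) - log (b k) ≤ (log A + Y / A - 1)/t := by
    rw [le_div_iff₀ ht]; nlinarith
  linarith

lemma pointwise {Ω : Type*} [Fintype Ω] [Nonempty Ω] (w1 w2 S : Ω → ℝ) (h1 : ∀ σ, 0 < w1 σ)
    (h2 : ∀ σ, 0 < w2 σ) (lab : Ω → ℤ) (v δ U V : ℝ) (hv : 0 ≤ v)
    (hδ : ∀ σ τ, lab σ = lab τ → (S σ - S τ)^2 ≤ δ^2)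
    (hU : ∀ k ∈ Finset.univ.image lab, Zp lab (fun σ => w1 σ * exp (2*v*S σ^2)) k
      ≤ exp U * Zp lab (fun σ => w2 σ * exp (2*v*S σ^2)) k)
    (hV : ∀ k ∈ Finset.univ.image lab, Zp lab (fun σ => w2 σ * exp (2*v*S σ^2)) k
      ≤ exp V * Zp lab (fun σ => w1 σ * exp (2*v*S σ^2)) k) :
    2 * v * ((∑ σ, S σ^2 * w1 σ) / (∑ σ, w1 σ) + (∑ σ, S σ^2 * w2 σ) / (∑ σ, w2 σ))
      ≤ v * ((∑ p : Ω × Ω, (S p.1 + S p.2)^2 * (w1 p.1 * w2 p.2 * exp (v * (S p.1 + S p.2)^2))) /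
          (∑ p : Ω × Ω, w1 p.1 * w2 p.2 * exp (v * (S p.1 + S p.2)^2)))
        + (v * δ^2 + 2 * log ((Finset.univ.image lab).card) + (U + V)/2) := by
  have hc := core w1 w2 S h1 h2 lab v δ U V hv hδ hU hV
  have j1 := gibbs_jensen w1 (fun σ => 2*v*S σ^2) h1
  have j2 := gibbs_jensen w2 (fun σ => 2*v*S σ^2) h2
  have j3 := gibbs_jensen (fun p : Ω × Ω => w1 p.1 * w2 p.2 * exp (v * (S p.1 + S p.2)^2))
    (fun p => -v * (S p.1 + S p.2)^2) (fun p => mul_pos (mul_pos (h1 _) (h2 _)) (exp_pos _))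
  have e : ∀ p : Ω × Ω, w1 p.1 * w2 p.2 * exp (v * (S p.1 + S p.2)^2) *
      exp (-v * (S p.1 + S p.2)^2) = w1 p.1 * w2 p.2 := by
    intro p; rw [mul_assoc, ← Real.exp_add]; ring_nf; simp
  simp only [e] at j3
  have e' : ∑ p : Ω × Ω, w1 p.1 * w2 p.2 = (∑ σ, w1 σ) * (∑ σ, w2 σ) := by
    rw [Finset.sum_mul_sum, ← Finset.sum_product', Finset.univ_product_univ]
  have s1 : 0 < ∑ σ, w1 σ := Finset.sum_pos (fun σ _ => h1 σ) Finset.univ_nonempty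
  have s2 : 0 < ∑ σ, w2 σ := Finset.sum_pos (fun σ _ => h2 σ) Finset.univ_nonempty
  rw [e', Real.log_mul s1.ne' s2.ne'] at j3
  simp only [mul_assoc (2*v), mul_assoc (-v), ← Finset.mul_sum, mul_div_assoc] at j1 j2 j3
  linarith

/-- first half -/
def lo {X : Type*} (N : ℕ) (x : Fin (2^(N+1)) → X) : Fin (2^N) → X :=
  fun i => x ⟨i.1, by have := i.2; rw [pow_succ]; omega⟩

/-- second half -/
def hi {X : Type*} (N : ℕ) (x : Fin (2^(N+1)) → X) : Fin (2^N) → X :=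
  fun i => x ⟨2^N + i.1, by have := i.2; rw [pow_succ]; omega⟩

/-- index splitting -/
def eidx (N : ℕ) : Fin (2^N) ⊕ Fin (2^N) ≃ Fin (2^(N+1)) :=
  finSumFinEquiv.trans (finCongr (by ring))

lemma sum_split (N : ℕ) (f : Fin (2^(N+1)) → ℝ) : ∑ i, f i = ∑ i, lo N f i + ∑ i, hi N f i := by
  rw [← (eidx N).sum_comp, Fintype.sum_sum_type]
  rfl

/-- configuration splitting -/
def ecfg (N : ℕ) : (Fin (2^(N+1)) → Bool) ≃ (Fin (2^N) → Bool) × (Fin (2^N) → Bool) :=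
  ((eidx N).symm.arrowCongr (Equiv.refl Bool)).trans (Equiv.sumArrowEquivProdArrow _ _ _)

lemma ecfg_apply (N : ℕ) (σ : Fin (2^(N+1)) → Bool) : ecfg N σ = (lo N σ, hi N σ) := rfl

/-- field splitting -/
def efld (N : ℕ) : (Fin (2^(N+1)) → ℝ) ≃ᵐ (Fin (2^N) → ℝ) × (Fin (2^N) → ℝ) :=
  (MeasurableEquiv.arrowCongr' (eidx N).symm (MeasurableEquiv.refl ℝ)).trans
    (MeasurableEquiv.sumPiEquivProdPi (fun _ => ℝ))

lemma efld_apply (N : ℕ) (η : Fin (2^(N+1)) → ℝ) : efld N η = (lo N η, hi N η) := rfl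

lemma efld_mp (N : ℕ) : MeasurePreserving (efld N) (gaussianFields (2^(N+1)))
    ((gaussianFields (2^N)).prod (gaussianFields (2^N))) := by
  unfold gaussianFields
  have h1 := measurePreserving_arrowCongr' (fun _ : Fin (2^(N+1)) => gaussianReal 0 1)
    (fun _ : Fin (2^N) ⊕ Fin (2^N) => gaussianReal 0 1) (eidx N).symm (MeasurableEquiv.refl ℝ)
    (fun _ => MeasurePreserving.id _)
  have h2 := measurePreserving_sumPiEquivProdPi (fun _ : Fin (2^N) ⊕ Fin (2^N) => gaussianReal 0 1)
  exact h2.comp h1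

lemma totalSpin_split (N : ℕ) (σ : Fin (2^(N+1)) → Bool) :
    totalSpin (N+1) σ = totalSpin N (lo N σ) + totalSpin N (hi N σ) := by
  unfold totalSpin
  rw [sum_split]; rfl

/-- Boltzmann weight -/
def Wt (α β fh : ℝ) (N : ℕ) (η : Fin (2^N) → ℝ) (σ : Fin (2^N) → Bool) : ℝ :=
  exp (-β * dysonHRF α fh N η σ)

lemma Wt_pos (α β fh : ℝ) (N : ℕ) (η : Fin (2^N) → ℝ) (σ : Fin (2^N) → Bool) :
    0 < Wt α β fh N η σ := exp_pos _

lemma Wt_split (α β fh : ℝ) (N : ℕ) (η : Fin (2^(N+1)) → ℝ) (σ : Fin (2^(N+1)) → Bool) :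
    Wt α β fh (N+1) η σ = Wt α β fh N (lo N η) (lo N σ) * Wt α β fh N (hi N η) (hi N σ) *
      exp ((β * (2:ℝ) ^ (-(α * ((N:ℝ)+1)))) * (totalSpin N (lo N σ) + totalSpin N (hi N σ))^2) := by
  unfold Wt
  rw [← Real.exp_add, ← Real.exp_add]
  congr 1
  have hd : dysonH α (N+1) σ = dysonH α N (lo N σ) + dysonH α N (hi N σ) -
      (2:ℝ) ^ (-(α * ((N:ℝ)+1))) * (totalSpin N (lo N σ) + totalSpin N (hi N σ))^2 := by
    rw [← totalSpin_split, totalSpin, sq, Finset.sum_mul_sum]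
    rfl
  have hs : ∑ i, η i * spin (σ i) = ∑ i, lo N η i * spin (lo N σ i) + ∑ i, hi N η i * spin (hi N σ i) :=
    sum_split N _
  unfold dysonHRF
  rw [hd, hs]
  ring

lemma gibbs_split (α β fh : ℝ) (N : ℕ) (η : Fin (2^(N+1)) → ℝ) :
    gibbs α β fh (N+1) η (fun σ => (totalSpin (N+1) σ)^2) =
      (∑ p : (Fin (2^N) → Bool) × (Fin (2^N) → Bool), (totalSpin N p.1 + totalSpin N p.2)^2 *
        (Wt α β fh N (lo N η) p.1 * Wt α β fh N (hi N η) p.2 *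
          exp ((β * (2:ℝ) ^ (-(α * ((N:ℝ)+1)))) * (totalSpin N p.1 + totalSpin N p.2)^2))) /
      (∑ p : (Fin (2^N) → Bool) × (Fin (2^N) → Bool),
        Wt α β fh N (lo N η) p.1 * Wt α β fh N (hi N η) p.2 *
          exp ((β * (2:ℝ) ^ (-(α * ((N:ℝ)+1)))) * (totalSpin N p.1 + totalSpin N p.2)^2)) := by
  rw [← (ecfg N).sum_comp, ← (ecfg N).sum_comp]
  simp only [ecfg_apply]
  simp only [← Wt_split]
  simp only [← totalSpin_split]
  rfl

lemma spin_abs (b : Bool) : |spin b| = 1 := by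
  cases b <;> simp [spin]

lemma totalSpin_abs (N : ℕ) (σ : Fin (2^N) → Bool) : |totalSpin N σ| ≤ 2^N := by
  unfold totalSpin
  refine (Finset.abs_sum_le_sum_abs _ _).trans ?_
  simp [spin_abs]

lemma Wt_cont (α β fh : ℝ) (N : ℕ) (σ : Fin (2^N) → Bool) :
    Continuous (fun η => Wt α β fh N η σ) := by
  unfold Wt dysonHRF
  fun_prop

lemma Wt_lip (α β fh : ℝ) (hβ : 0 < β) (hf : 0 < fh) (N : ℕ) (η η' : Fin (2^N) → ℝ)
    (σ : Fin (2^N) → Bool) :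
    Wt α β fh N η σ ≤ exp (β * fh * ∑ i, |η i - η' i|) * Wt α β fh N η' σ := by
  unfold Wt
  rw [← Real.exp_add]
  apply Real.exp_le_exp.2
  unfold dysonHRF
  have : ∑ i, η i * spin (σ i) - ∑ i, η' i * spin (σ i) ≤ ∑ i, |η i - η' i| := by
    rw [← Finset.sum_sub_distrib]
    refine Finset.sum_le_sum fun i _ => ?_
    rw [← sub_mul]
    refine (le_abs_self _).trans ?_
    rw [abs_mul, spin_abs, mul_one]
  nlinarith [mul_le_mul_of_nonneg_left this (mul_pos hβ hf).le]

lemma gibbs_eq (α β fh : ℝ) (N : ℕ) (η : Fin (2^N) → ℝ) :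
    gibbs α β fh N η (fun σ => (totalSpin N σ)^2) =
      (∑ σ, (totalSpin N σ)^2 * Wt α β fh N η σ) / (∑ σ, Wt α β fh N η σ) := rfl

lemma gibbs_bd (α β fh : ℝ) (N : ℕ) (η : Fin (2^N) → ℝ) :
    0 ≤ gibbs α β fh N η (fun σ => (totalSpin N σ)^2) ∧
    gibbs α β fh N η (fun σ => (totalSpin N σ)^2) ≤ 2^(2*N) := by
  rw [gibbs_eq]
  have hs : 0 < ∑ σ, Wt α β fh N η σ :=
    Finset.sum_pos (fun σ _ => Wt_pos _ _ _ _ _ _) Finset.univ_nonempty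
  refine ⟨div_nonneg (Finset.sum_nonneg fun σ _ => mul_nonneg (sq_nonneg _) (Wt_pos _ _ _ _ _ _).le)
    hs.le, ?_⟩
  rw [div_le_iff₀ hs, Finset.mul_sum]
  refine Finset.sum_le_sum fun σ _ => mul_le_mul_of_nonneg_right ?_ (Wt_pos _ _ _ _ _ _).le
  rw [← sq_abs, pow_mul']
  exact pow_le_pow_left₀ (abs_nonneg _) (totalSpin_abs N σ) 2

lemma gibbs_cont (α β fh : ℝ) (N : ℕ) :
    Continuous (fun η => gibbs α β fh N η (fun σ => (totalSpin N σ)^2)) := by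
  simp only [gibbs_eq]
  refine Continuous.div ?_ ?_ (fun η => (Finset.sum_pos (fun σ _ => Wt_pos _ _ _ _ _ _)
    Finset.univ_nonempty).ne')
  · exact continuous_finsetSum _ fun σ _ => continuous_const.mul (Wt_cont _ _ _ _ _)
  · exact continuous_finsetSum _ fun σ _ => (Wt_cont _ _ _ _ _)

lemma gibbs_int (α β fh : ℝ) (N : ℕ) :
    Integrable (fun η => gibbs α β fh N η (fun σ => (totalSpin N σ)^2)) (gaussianFields (2^N)) := by
  refine (integrable_const ((2:ℝ)^(2*N))).mono' (gibbs_cont α β fh N).aestronglyMeasurable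
    (Eventually.of_forall fun η => ?_)
  rw [Real.norm_eq_abs, abs_of_nonneg (gibbs_bd _ _ _ _ _).1]
  exact (gibbs_bd _ _ _ _ _).2

lemma Zp_pow_lip (α β fh : ℝ) (hβ : 0 < β) (hf : 0 < fh) (N : ℕ) (lab : (Fin (2^N) → Bool) → ℤ)
    (c : (Fin (2^N) → Bool) → ℝ) (t : ℝ) (ht : 0 < t) (k : ℤ)
    (hk : k ∈ Finset.univ.image lab) :
    Measurable (fun η => (Zp lab (fun σ => Wt α β fh N η σ * exp (c σ)) k) ^ t) ∧
    (∀ η, 0 < (Zp lab (fun σ => Wt α β fh N η σ * exp (c σ)) k) ^ t) ∧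
    ∀ η η', (Zp lab (fun σ => Wt α β fh N η σ * exp (c σ)) k) ^ t ≤
      exp ((t * β * fh) * ∑ i, |η i - η' i|) *
        (Zp lab (fun σ => Wt α β fh N η' σ * exp (c σ)) k) ^ t := by
  have hpos : ∀ η, 0 < Zp lab (fun σ => Wt α β fh N η σ * exp (c σ)) k := fun η =>
    Zp_pos lab _ (fun σ => mul_pos (Wt_pos _ _ _ _ _ _) (exp_pos _)) k hk
  refine ⟨?_, fun η => Real.rpow_pos_of_pos (hpos η) t, fun η η' => ?_⟩
  · have : Continuous (fun η => Zp lab (fun σ => Wt α β fh N η σ * exp (c σ)) k) := by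
      unfold Zp
      exact continuous_finsetSum _ fun σ _ => (Wt_cont _ _ _ _ _).mul continuous_const
    exact this.measurable.pow_const t
  · have h1 : Zp lab (fun σ => Wt α β fh N η σ * exp (c σ)) k ≤
        exp (β * fh * ∑ i, |η i - η' i|) * Zp lab (fun σ => Wt α β fh N η' σ * exp (c σ)) k := by
      unfold Zp
      rw [Finset.mul_sum]
      refine Finset.sum_le_sum fun σ _ => ?_
      rw [← mul_assoc]
      exact mul_le_mul_of_nonneg_right (Wt_lip α β fh hβ hf N η η' σ) (exp_pos _).le
    refine (Real.rpow_le_rpow (hpos η).le h1 ht.le).trans (le_of_eq ?_)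
    rw [Real.mul_rpow (exp_pos _).le (hpos η').le, ← Real.exp_mul]
    congr 2; ring

lemma step (α β fh : ℝ) (hβ : 0 < β) (hf : 0 < fh) (N r : ℕ) (hr : 1 ≤ r) (t v : ℝ) (ht : 0 < t)
    (hv : v = β * (2:ℝ) ^ (-(α * ((N:ℝ)+1)))) :
    4 * v * (∫ η, gibbs α β fh N η (fun σ => (totalSpin N σ)^2) ∂ gaussianFields (2^N)) ≤
      v * (∫ η, gibbs α β fh (N+1) η (fun σ => (totalSpin (N+1) σ)^2) ∂ gaussianFields (2^(N+1)))
      + (v * ((2:ℝ)^(N+1)/r)^2 + 2 * log (r+1) + (log (r+1) + 2^N * (t * β * fh)^2)/t) := by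
  have hr0 : (0:ℝ) < r := by exact_mod_cast hr
  have hv0 : 0 ≤ v := by rw [hv]; positivity
  set δ : ℝ := (2:ℝ)^(N+1)/r with hδ
  have hδ0 : 0 < δ := by positivity
  set lab : (Fin (2^N) → Bool) → ℤ := fun σ => ⌊(totalSpin N σ + 2^N)/δ⌋ with hlab
  have hlabδ : ∀ σ τ, lab σ = lab τ → (totalSpin N σ - totalSpin N τ)^2 ≤ δ^2 := by
    intro σ τ h
    have h1 := Int.abs_sub_lt_one_of_floor_eq_floor h
    rw [← sub_div, abs_div, abs_of_pos hδ0, div_lt_one hδ0] at h1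
    apply sq_le_sq.2
    rw [abs_of_pos hδ0]
    refine le_trans (le_of_eq ?_) h1.le
    congr 1; ring
  set K := Finset.univ.image lab with hK
  have hKcard : (K.card : ℝ) ≤ r + 1 := by
    have : K ⊆ Finset.Icc (0:ℤ) r := by
      intro k hk
      obtain ⟨σ, _, rfl⟩ := Finset.mem_image.1 hk
      have := abs_le.1 (totalSpin_abs N σ)
      rw [Finset.mem_Icc]
      refine ⟨Int.floor_nonneg.2 (div_nonneg (by linarith) hδ0.le), ?_⟩
      have h2 : (totalSpin N σ + 2^N)/δ ≤ r := by
        rw [div_le_iff₀ hδ0, hδ, mul_div_cancel₀ _ hr0.ne', pow_succ]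
        linarith
      have := (Int.floor_le ((totalSpin N σ + 2^N)/δ)).trans h2
      exact Int.cast_le.1 (le_trans this (by simp))
    have := Finset.card_le_card this
    rw [Int.card_Icc] at this
    have h3 : K.card ≤ r + 1 := by omega
    exact_mod_cast h3
  have hKp : (0:ℝ) < K.card := by
    exact_mod_cast Finset.card_pos.2 (Finset.univ_nonempty.image lab)
  set a : (Fin (2^N) → ℝ) → ℤ → ℝ := fun η k =>
    Zp lab (fun σ => Wt α β fh N η σ * exp (2*v*totalSpin N σ^2)) k with ha
  have hap : ∀ η, ∀ k ∈ K, 0 < a η k := fun η k hk =>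
    Zp_pos lab _ (fun σ => mul_pos (Wt_pos _ _ _ _ _ _) (exp_pos _)) k hk
  set E : ℝ := 2^N * (t * β * fh)^2 with hE
  set A : ℝ := (r+1) * exp E with hA
  have hA0 : 0 < A := by positivity
  set μ := gaussianFields (2^N) with hμ
  have hlog : log A = log (r+1) + E := by
    rw [hA, Real.log_mul (by positivity) (exp_pos _).ne', Real.log_exp]
  set Y : (Fin (2^N) → ℝ) → (Fin (2^N) → ℝ) → ℝ := fun x y => ∑ j ∈ K, a x j ^ t * (a y j ^ t)⁻¹ with hY
  have hlip := Zp_pow_lip α β fh hβ hf N lab (fun σ => 2*v*totalSpin N σ^2) t ht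
  have iF : ∀ k ∈ K, Integrable (fun η => a η k ^ t) μ := fun k hk =>
    lip_integrable (hlip k hk).1 (hlip k hk).2.1 (hlip k hk).2.2
  have iG : ∀ k ∈ K, Integrable (fun η => (a η k ^ t)⁻¹) μ := fun k hk =>
    lip_integrable (hlip k hk).1.inv (fun η => inv_pos.2 ((hlip k hk).2.1 η))
      (lip_inv (hlip k hk).2.1 (hlip k hk).2.2)
  have hmom : ∀ k ∈ K, (∫ η, a η k ^ t ∂μ) * (∫ η, (a η k ^ t)⁻¹ ∂μ) ≤ exp E := by
    intro k hk
    have := exp_mom (L := t * β * fh) (2^N) (fun η => a η k ^ t) (hlip k hk).1 (hlip k hk).2.1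
      (hlip k hk).2.2
    simpa [hE] using this
  have iY : Integrable (fun z : (Fin (2^N) → ℝ) × (Fin (2^N) → ℝ) => Y z.1 z.2) (μ.prod μ) :=
    integrable_finsetSum _ fun k hk => (iF k hk).mul_prod (iG k hk)
  have iY' : Integrable (fun z : (Fin (2^N) → ℝ) × (Fin (2^N) → ℝ) => Y z.2 z.1) (μ.prod μ) :=
    iY.swap
  have eY : ∫ z, Y z.1 z.2 ∂(μ.prod μ) ≤ A := by
    simp only [hY]
    rw [integral_finsetSum _ fun k hk => (iF k hk).mul_prod (iG k hk)]
    calc _ ≤ ∑ k ∈ K, exp E := Finset.sum_le_sum fun k hk => by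
          rw [integral_prod_mul (fun η => a η k ^ t) (fun η => (a η k ^ t)⁻¹)]
          exact hmom k hk
      _ = K.card * exp E := by rw [Finset.sum_const, nsmul_eq_mul]
      _ ≤ A := mul_le_mul_of_nonneg_right hKcard (exp_pos _).le
  have eY' : ∫ z : (Fin (2^N) → ℝ) × (Fin (2^N) → ℝ), Y z.2 z.1 ∂(μ.prod μ) ≤ A := by
    have := integral_prod_swap (μ := μ) (ν := μ)
      (fun z : (Fin (2^N) → ℝ) × (Fin (2^N) → ℝ) => Y z.1 z.2)
    simp only [Prod.fst_swap, Prod.snd_swap] at this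
    rw [this]; exact eY
  set g : (Fin (2^N) → ℝ) → ℝ := fun η => gibbs α β fh N η (fun σ => (totalSpin N σ)^2) with hg
  set G : (Fin (2^(N+1)) → ℝ) → ℝ :=
    fun η => gibbs α β fh (N+1) η (fun σ => (totalSpin (N+1) σ)^2) with hG
  have hpt : ∀ η : Fin (2^(N+1)) → ℝ, 2 * v * (g (efld N η).1 + g (efld N η).2) ≤ v * G η +
      (v * δ^2 + 2 * log (r+1) + ((log A + Y (efld N η).1 (efld N η).2 / A - 1)/t
        + (log A + Y (efld N η).2 (efld N η).1 / A - 1)/t)/2) := by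
    intro η
    rw [efld_apply]
    have h1 := pointwise (Wt α β fh N (lo N η)) (Wt α β fh N (hi N η)) (totalSpin N)
      (Wt_pos _ _ _ _ _) (Wt_pos _ _ _ _ _) lab v δ _ _ hv0 hlabδ
      (ratio_bd K (a (lo N η)) (a (hi N η)) (hap _) (hap _) t A ht hA0)
      (ratio_bd K (a (hi N η)) (a (lo N η)) (hap _) (hap _) t A ht hA0)
    have h2 : log (K.card) ≤ log (r+1) := Real.log_le_log hKp hKcard
    have h3 := gibbs_split α β fh N η
    rw [← hv] at h3
    simp only [hG, h3]
    simp only [hg, gibbs_eq]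
    simp only [hY]
    linarith
  have mp := efld_mp N
  have ig := gibbs_int α β fh N
  have iGG := gibbs_int α β fh (N+1)
  have iX : ∀ X : (Fin (2^N) → ℝ) × (Fin (2^N) → ℝ) → ℝ, Integrable X (μ.prod μ) →
      Integrable (fun η => X (efld N η)) (gaussianFields (2^(N+1))) := fun X hX =>
    (mp.integrable_comp_emb (efld N).measurableEmbedding).2 hX
  have eX : ∀ X : (Fin (2^N) → ℝ) × (Fin (2^N) → ℝ) → ℝ,
      ∫ η, X (efld N η) ∂(gaussianFields (2^(N+1))) = ∫ z, X z ∂(μ.prod μ) := fun X =>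
    mp.integral_comp (efld N).measurableEmbedding X
  have ig1 : Integrable (fun z : (Fin (2^N) → ℝ) × (Fin (2^N) → ℝ) => g z.1) (μ.prod μ) :=
    ig.comp_fst μ
  have ig2 : Integrable (fun z : (Fin (2^N) → ℝ) × (Fin (2^N) → ℝ) => g z.2) (μ.prod μ) :=
    ig.comp_snd μ
  have eg1 : ∫ z : (Fin (2^N) → ℝ) × (Fin (2^N) → ℝ), g z.1 ∂(μ.prod μ) = ∫ x, g x ∂μ := by
    rw [integral_fun_fst]; simp
  have eg2 : ∫ z : (Fin (2^N) → ℝ) × (Fin (2^N) → ℝ), g z.2 ∂(μ.prod μ) = ∫ x, g x ∂μ := by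
    rw [integral_fun_snd]; simp
  have jg1 := iX _ ig1
  have jg2 := iX _ ig2
  have jY1 := iX _ iY
  have jY2 := iX _ iY'
  have fg1 := (eX (fun z => g z.1)).trans eg1
  have fg2 := (eX (fun z => g z.2)).trans eg2
  have fY1 := (eX (fun z => Y z.1 z.2)).le.trans eY
  have fY2 := (eX (fun z => Y z.2 z.1)).le.trans eY'
  set C : ℝ := v * δ^2 + 2 * log (r+1) + (log A - 1)/t with hC
  have hpt' : ∀ η : Fin (2^(N+1)) → ℝ,
      2 * v * (g (efld N η).1 + g (efld N η).2) ≤ v * G η +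
      (C + (2 * t * A)⁻¹ * (Y (efld N η).1 (efld N η).2 + Y (efld N η).2 (efld N η).1)) := by
    intro η
    refine (hpt η).trans (le_of_eq ?_)
    rw [hC]
    field_simp
    ring
  have key := integral_mono ((jg1.add jg2).const_mul (2*v))
    ((iGG.const_mul v).add ((integrable_const C).add ((jY1.add jY2).const_mul (2*t*A)⁻¹))) hpt'
  have l1 : ∫ η, 2 * v * (g (efld N η).1 + g (efld N η).2) ∂(gaussianFields (2^(N+1)))
      = 4 * v * ∫ x, g x ∂μ := by
    rw [integral_const_mul, integral_add jg1 jg2, fg1, fg2]; ring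
  have l2 : ∫ η, (v * G η + (C + (2 * t * A)⁻¹ * (Y (efld N η).1 (efld N η).2
      + Y (efld N η).2 (efld N η).1))) ∂(gaussianFields (2^(N+1)))
      ≤ v * (∫ η, G η ∂(gaussianFields (2^(N+1)))) + (C + 1/t) := by
    have jG : Integrable (fun η => v * G η) (gaussianFields (2^(N+1))) := iGG.const_mul v
    have jY : Integrable (fun η => (2 * t * A)⁻¹ * (Y (efld N η).1 (efld N η).2
      + Y (efld N η).2 (efld N η).1)) (gaussianFields (2^(N+1))) := (jY1.add jY2).const_mul (2*t*A)⁻¹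
    have jC : Integrable (fun η => C + (2 * t * A)⁻¹ * (Y (efld N η).1 (efld N η).2
      + Y (efld N η).2 (efld N η).1)) (gaussianFields (2^(N+1))) := (integrable_const C).add jY
    rw [integral_add jG jC, integral_add (integrable_const C) jY,
      integral_const_mul, integral_const_mul]
    have : ∫ η, (Y (efld N η).1 (efld N η).2 + Y (efld N η).2 (efld N η).1)
        ∂(gaussianFields (2^(N+1))) ≤ 2 * A := by
      rw [integral_add jY1 jY2]; linarith
    have h4 := mul_le_mul_of_nonneg_left this (show 0 ≤ (2*t*A)⁻¹ by positivity)
    have h5 : (2*t*A)⁻¹ * (2 * A) = 1/t := by field_simp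
    simp only [integral_const, probReal_univ, smul_eq_mul, one_mul]
    linarith
  have key2 := (l1.symm.le.trans key).trans l2
  refine key2.trans (le_of_eq ?_)
  rw [hC, hlog]
  field_simp
  ring

lemma fG_zero (α β fh : ℝ) : fG α β fh 0 = 1 := by
  have h : ∀ η, gibbs α β fh 0 η (fun σ => (totalSpin 0 σ)^2) = 1 := by
    intro η
    rw [gibbs_eq]
    have h1 : ∀ σ : Fin (2^0) → Bool, totalSpin 0 σ ^ 2 = 1 := by
      intro σ
      have : totalSpin 0 σ = spin (σ 0) := by
        unfold totalSpin
        exact Fin.sum_univ_one (fun i => spin (σ i))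
      rw [this, ← sq_abs, spin_abs]; norm_num
    simp only [h1, one_mul]
    exact div_self (Finset.sum_pos (fun σ _ => Wt_pos _ _ _ _ _ _) Finset.univ_nonempty).ne'
  unfold fG
  simp only [h]
  rw [integral_const, probReal_univ]
  simp

lemma fG_le_one (α β fh : ℝ) (N : ℕ) : fG α β fh N ≤ 1 := by
  unfold fG
  rw [inv_mul_le_iff₀ (by positivity), mul_one]
  have := integral_mono (gibbs_int α β fh N) (integrable_const ((2:ℝ)^(2*N)))
    (fun η => (gibbs_bd α β fh N η).2)
  simpa using this

lemma fG_step (α β fh : ℝ) (hβ : 0 < β) (hf : 0 < fh) (N : ℕ) :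
    fG α β fh N ≤ fG α β fh (N+1) + (1/((N:ℝ)+4) - 1/((N:ℝ)+5)) +
      (2/β + fh) * (((N:ℝ)+6) * (√2 / (2:ℝ)^(2-α))^(N+1)) := by
  set s : ℝ := √2 ^ (N+1) with hs
  have hs0 : 0 < s := by positivity
  have hs1 : 1 ≤ s := one_le_pow₀ (Real.one_le_sqrt.2 (by norm_num))
  have hs2 : s^2 = 2 * 2^N := by
    rw [hs, ← pow_mul, mul_comm (N+1) 2, pow_mul, Real.sq_sqrt (by norm_num)]; ring
  set b : ℝ := ((2:ℝ)^(2-α))^(N+1) with hb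
  have hb0 : 0 < b := by positivity
  set v : ℝ := β * (2:ℝ) ^ (-(α * ((N:ℝ)+1))) with hv
  have hvb : v * (2:ℝ)^(2*(N+1)) = β * b := by
    rw [hv, hb, mul_assoc]
    congr 1
    rw [← Real.rpow_natCast, ← Real.rpow_natCast, ← Real.rpow_mul (by norm_num),
      ← Real.rpow_add (by norm_num)]
    congr 1; push_cast; ring
  have ht : 0 < 1/(β * fh * s) := by positivity
  have h := step α β fh hβ hf N (N+5) (by omega) (1/(β*fh*s)) v ht hv
  have e1 : (2:ℝ)^N * (1/(β*fh*s) * β * fh)^2 = 1/2 := by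
    have : (1/(β*fh*s) * β * fh) = 1/s := by field_simp
    rw [this, div_pow, hs2]; field_simp
  rw [e1] at h
  set I := (∫ η, gibbs α β fh N η (fun σ => (totalSpin N σ)^2) ∂ gaussianFields (2^N)) with hI
  set J := (∫ η, gibbs α β fh (N+1) η (fun σ => (totalSpin (N+1) σ)^2) ∂ gaussianFields (2^(N+1)))
    with hJ
  have eI : 4 * v * I = β * b * fG α β fh N := by
    rw [← hvb]; unfold fG; rw [← hI]
    field_simp; ring
  have eJ : v * J = β * b * fG α β fh (N+1) := by
    rw [← hvb]; unfold fG; rw [← hJ]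
    field_simp
  have eδ : v * ((2:ℝ)^(N+1)/((N+5:ℕ):ℝ))^2 = β * b * (1/((N:ℝ)+5)^2) := by
    rw [← hvb, div_pow, ← pow_mul, mul_comm (N+1) 2]; push_cast; field_simp
  have hlog : log (((N+5:ℕ):ℝ) + 1) ≤ (N:ℝ) + 5 := by
    have := Real.log_le_sub_one_of_pos (show (0:ℝ) < ((N+5:ℕ):ℝ) + 1 by positivity)
    push_cast at this ⊢
    linarith
  rw [eI, eJ, eδ] at h
  set l := log (((N+5:ℕ):ℝ) + 1)
  have h2 : (l + 1/2) / (1/(β*fh*s)) ≤ β * fh * s * ((N:ℝ) + 6) := by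
    rw [div_div_eq_mul_div, div_one, mul_comm]
    exact mul_le_mul_of_nonneg_left (by linarith) (by positivity)
  have h3 : 2 * l ≤ 2 * ((N:ℝ)+6) * s := by
    have : (N:ℝ) + 6 ≤ ((N:ℝ)+6) * s := le_mul_of_one_le_right (by positivity) hs1
    nlinarith
  have h4 : 1/((N:ℝ)+5)^2 ≤ 1/((N:ℝ)+4) - 1/((N:ℝ)+5) := by
    rw [div_sub_div _ _ (by positivity) (by positivity), div_le_div_iff₀ (by positivity) (by positivity)]
    ring_nf
    nlinarith [(Nat.cast_nonneg N : (0:ℝ) ≤ N)]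
  have hβb : 0 < β * b := by positivity
  have e5 : (2/β + fh) * (((N:ℝ)+6) * (√2 / (2:ℝ)^(2-α))^(N+1))
      = (2 * ((N:ℝ)+6) * s + β * fh * s * ((N:ℝ) + 6)) / (β * b) := by
    rw [div_pow, ← hs, ← hb]; field_simp
  rw [e5]
  have h6 : fG α β fh N ≤ fG α β fh (N+1) + 1/((N:ℝ)+5)^2 +
      (2 * ((N:ℝ)+6) * s + β * fh * s * ((N:ℝ) + 6)) / (β * b) := by
    refine le_of_mul_le_mul_left ?_ hβb
    rw [mul_add, mul_add, mul_div_cancel₀ _ hβb.ne']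
    linarith
  linarith

lemma rho_lt (α : ℝ) (hα2 : α < 3/2) : √2 / (2:ℝ)^(2-α) < 1 := by
  rw [div_lt_one (by positivity), Real.sqrt_eq_rpow]
  exact Real.rpow_lt_rpow_of_exponent_lt (by norm_num) (by linarith)

end Helpers

/-- Corollary (gaussian random fields): for `1 < α < 3/2` there is long-range order
(`m² > 0`) at sufficiently low temperature and sufficiently small nonzero field strength. -/
theorem rfim_dyson_lro_exists_gaussian (α : ℝ) (hα1 : 1 < α) (hα2 : α < 3/2) :
    ∃ h0 > (0:ℝ), ∃ β0 > (0:ℝ), ∀ fh : ℝ, 0 < fh → fh ≤ h0 → ∀ β : ℝ, β0 ≤ β →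
      0 < Filter.liminf (fun N => fG α β fh N) Filter.atTop := by
  set ρ : ℝ := √2 / (2:ℝ)^(2-α) with hρ
  have hρ1 : ρ < 1 := rho_lt α hα2
  have hρ0 : 0 < ρ := by positivity
  have hsum : Summable (fun k : ℕ => ((k:ℝ)+6) * ρ^(k+1)) := by
    have hn : ‖ρ‖ < 1 := by rw [Real.norm_eq_abs, abs_of_pos hρ0]; exact hρ1
    have s1 := summable_pow_mul_geometric_of_norm_lt_one 1 hn
    have s2 := summable_geometric_of_norm_lt_one hn
    refine ((s1.mul_left ρ).add (s2.mul_left (6*ρ))).congr fun k => ?_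
    ring
  set C : ℝ := ∑' k : ℕ, ((k:ℝ)+6) * ρ^(k+1) with hC
  have hC0 : 0 ≤ C := tsum_nonneg fun k => by positivity
  refine ⟨1/(8*(C+1)), by positivity, 16*(C+1), by positivity, ?_⟩
  intro fh hf hfh β hβ
  have hβ0 : 0 < β := by linarith
  have hx : (2/β + fh) * C ≤ 1/4 := by
    have h1 : 2/β ≤ 1/(8*(C+1)) := by
      rw [div_le_div_iff₀ hβ0 (by positivity)]; linarith
    have h2 : (2/β + fh) * C ≤ (1/(8*(C+1)) + 1/(8*(C+1))) * C :=
      mul_le_mul_of_nonneg_right (by linarith) hC0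
    refine h2.trans ?_
    rw [← add_div, div_mul_eq_mul_div, div_le_div_iff₀ (by positivity) (by norm_num)]
    linarith
  have hind : ∀ N : ℕ, 1 ≤ fG α β fh N + (1/4 - 1/((N:ℝ)+4)) +
      (2/β + fh) * ∑ k ∈ Finset.range N, ((k:ℝ)+6) * ρ^(k+1) := by
    intro N
    induction N with
    | zero => rw [fG_zero]; simp
    | succ n ih =>
      have := fG_step α β fh hβ0 hf n
      rw [← hρ] at this
      rw [Finset.sum_range_succ, mul_add]
      have e : ((n+1:ℕ):ℝ) + 4 = (n:ℝ) + 5 := by push_cast; ring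
      rw [e]
      linarith
  have hlow : ∀ N : ℕ, 1/2 ≤ fG α β fh N := by
    intro N
    have h1 : ∑ k ∈ Finset.range N, ((k:ℝ)+6) * ρ^(k+1) ≤ C :=
      hsum.sum_le_tsum _ (fun k _ => by positivity)
    have h2 := mul_le_mul_of_nonneg_left h1 (show 0 ≤ 2/β + fh by positivity)
    have h3 : (0:ℝ) ≤ 1/((N:ℝ)+4) := by positivity
    linarith [hind N]
  have hcob : Filter.IsCoboundedUnder (· ≥ ·) Filter.atTop (fun N => fG α β fh N) :=
    Filter.IsBoundedUnder.isCoboundedUnder_ge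
      (Filter.isBoundedUnder_of ⟨1, fun N => fG_le_one α β fh N⟩)
  have := Filter.le_liminf_of_le hcob (Filter.Eventually.of_forall hlow)
  linarith

end
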